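/- Suppose ρ₁ ≠ ρ₂. If c'' = c/(ρ₁⁻¹ − ρ₂⁻¹) is not a rational number, then μ_{M,D} is not a spectral measure. -/

import Mathlib

open MeasureTheory Complex Matrix
open scoped ENNReal

noncomputable section

/-- The exponential function `e_λ(x) = e^{-2πi⟨λ,x⟩}` on `ℝ²`. -/
def expChar (lam x : Fin 2 → ℝ) : ℂ :=
  Complex.exp ((-2 * Real.pi * Complex.I) * ((lam 0 * x 0 + lam 1 * x 1 : ℝ) : ℂ))

/-- The Fourier transform `μ̂(ξ) = ∫ e^{-2πi⟨ξ,x⟩} dμ(x)` of a measure on `ℝ²`. -/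
def ftMeasure (μ : Measure (Fin 2 → ℝ)) (ξ : Fin 2 → ℝ) : ℂ :=
  ∫ x, expChar ξ x ∂μ

/-- The mask `m_D(ξ) = (1/p) Σ_{d∈D} e^{-2πi⟨ξ,d⟩}` of a digit system `D : Fin p → ℝ²`. -/
def mask {p : ℕ} (D : Fin p → (Fin 2 → ℝ)) (ξ : Fin 2 → ℝ) : ℂ :=
  (p : ℂ)⁻¹ * ∑ i : Fin p, expChar ξ (D i)

/-- Integer digits, coerced to real vectors. -/
def digitR {p : ℕ} (D : Fin p → (Fin 2 → ℤ)) : Fin p → (Fin 2 → ℝ) :=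
  fun i j => (D i j : ℝ)

/-- `μ` is the self-affine measure of the IFS `φ_d(x) = M⁻¹(x+d)`, `d ∈ D`:
a compactly supported Borel probability measure with `μ = (1/#D) Σ_d μ ∘ φ_d⁻¹`. -/
def IsSelfAffine {p : ℕ} (μ : Measure (Fin 2 → ℝ)) (M : Matrix (Fin 2) (Fin 2) ℝ)
    (D : Fin p → (Fin 2 → ℝ)) : Prop :=
  IsProbabilityMeasure μ ∧ (∃ K : Set (Fin 2 → ℝ), IsCompact K ∧ μ Kᶜ = 0) ∧
  μ = (p : ℝ≥0∞)⁻¹ • ∑ i : Fin p, μ.map (fun x => M⁻¹.mulVec (x + D i))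

/-- `Λ` is an orthogonal set of exponentials for `μ`. -/
def IsOrthoSet (μ : Measure (Fin 2 → ℝ)) (Λ : Set (Fin 2 → ℝ)) : Prop :=
  ∀ l ∈ Λ, ∀ l' ∈ Λ, l ≠ l' → ftMeasure μ (l - l') = 0

/-- `μ` is a spectral measure: some countable set of exponentials forms an
orthonormal (Hilbert) basis of `L²(μ)`. -/
def IsSpectral (μ : Measure (Fin 2 → ℝ)) : Prop :=
  ∃ Λ : Set (Fin 2 → ℝ), Λ.Countable ∧
    ∃ b : HilbertBasis Λ ℂ (Lp ℂ 2 μ),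
      ∀ lam : Λ, ⇑(b lam) =ᵐ[μ] expChar (lam : Fin 2 → ℝ)

/-- The standing assumption on the digit set: `a = (a₁,a₂)` has entries in `[1,p-1]`
and `Z(m_D) = ⋃_{j=1}^{p-1} (j·a/p + ℤ²)`. -/
def ZeroSetCond (p : ℕ) (D : Fin p → (Fin 2 → ℤ)) (a : Fin 2 → ℤ) : Prop :=
  (∀ i, 1 ≤ a i ∧ a i ≤ (p : ℤ) - 1) ∧
  ∀ ξ : Fin 2 → ℝ, mask (digitR D) ξ = 0 ↔
    ∃ j : ℕ, 1 ≤ j ∧ j ≤ p - 1 ∧ ∃ k : Fin 2 → ℤ,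
      ∀ i, ξ i = (j : ℝ) * (a i : ℝ) / p + (k i : ℝ)

/-- The upper-triangular expanding matrix `M = [[ρ₁⁻¹, c],[0, ρ₂⁻¹]]`. -/
def Mupper (ρ₁ ρ₂ c : ℝ) : Matrix (Fin 2) (Fin 2) ℝ := !![ρ₁⁻¹, c; 0, ρ₂⁻¹]

/-- The set `E_a = {h/l : gcd(h,l)=1, l·a₂ − h·a₁ ∈ ℤ∖pℤ} ∪ {0}`. -/
def Ea (p : ℕ) (a : Fin 2 → ℤ) : Set ℝ :=
  {x | ∃ h l : ℤ, Int.gcd h l = 1 ∧ ¬ ((p : ℤ) ∣ (l * a 1 - h * a 0)) ∧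
    x = (h : ℝ) / (l : ℝ)} ∪ {0}




theorem aux_expo (α β X Y Z : ℝ) (hα : 0 < α) (hβ : 0 < β) (hα1 : α ≠ 1) (hβ1 : β ≠ 1)
    (a b c : ℕ) (hab : a < b) (hbc : b < c)
    (ha : X * α ^ a + Y * β ^ a + Z = 0) (hb : X * α ^ b + Y * β ^ b + Z = 0)
    (hc : X * α ^ c + Y * β ^ c + Z = 0) : Z = 0 := by
  set h : ℝ → ℝ := fun t => X * α ^ t + Y * β ^ t + Z with hh
  have hder : ∀ t, HasDerivAt h (X * (α ^ t * Real.log α) + Y * (β ^ t * Real.log β)) t := by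
    intro t
    have h1 := (Real.hasStrictDerivAt_const_rpow hα t).hasDerivAt
    have h2 := (Real.hasStrictDerivAt_const_rpow hβ t).hasDerivAt
    exact ((h1.const_mul X).add (h2.const_mul Y)).add_const Z
  have hcont : Continuous h := continuous_iff_continuousAt.2 fun t => (hder t).continuousAt
  have hva : h a = 0 := by simpa [hh, Real.rpow_natCast] using ha
  have hvb : h b = 0 := by simpa [hh, Real.rpow_natCast] using hb
  have hvc : h c = 0 := by simpa [hh, Real.rpow_natCast] using hc
  obtain ⟨s, ⟨_, hs2⟩, hs⟩ := exists_hasDerivAt_eq_zero (f := h) (a := (a : ℝ)) (b := (b : ℝ))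
    (by exact_mod_cast hab) hcont.continuousOn (by rw [hva, hvb]) (fun t _ => hder t)
  obtain ⟨t, ⟨ht1, _⟩, ht⟩ := exists_hasDerivAt_eq_zero (f := h) (a := (b : ℝ)) (b := (c : ℝ))
    (by exact_mod_cast hbc) hcont.continuousOn (by rw [hvb, hvc]) (fun t _ => hder t)
  have hst : s < t := hs2.trans ht1
  have hla : Real.log α ≠ 0 := Real.log_ne_zero_of_pos_of_ne_one hα hα1
  have hlb : Real.log β ≠ 0 := Real.log_ne_zero_of_pos_of_ne_one hβ hβ1
  have pa := Real.rpow_pos_of_pos hα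
  have pb := Real.rpow_pos_of_pos hβ
  by_cases hαβ : α = β
  · subst hαβ
    have : (α ^ s * Real.log α) * (X + Y) = 0 := by linarith
    have hXY : X + Y = 0 := by
      rcases mul_eq_zero.1 this with h | h
      · exact absurd h (mul_ne_zero (pa s).ne' hla)
      · exact h
    have : (X + Y) * α ^ a + Z = 0 := by linarith
    rw [hXY] at this; linarith
  · have hX : X = 0 := by
      by_contra hX
      -- multiply
      have e1 : X * Real.log α * (α ^ s * β ^ t - α ^ t * β ^ s) = 0 := by
        linear_combination β ^ t * hs - β ^ s * ht
      have e2 : α ^ s * β ^ t = α ^ t * β ^ s := by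
        rcases mul_eq_zero.1 e1 with h | h
        · exact absurd h (mul_ne_zero hX hla)
        · linarith
      have e3 : (α / β) ^ s = (α / β) ^ t := by
        rw [Real.div_rpow hα.le hβ.le, Real.div_rpow hα.le hβ.le, div_eq_div_iff (pb s).ne' (pb t).ne']
        exact e2
      have e4 : (α/β) ≠ 1 := by
        intro h; rw [div_eq_one_iff_eq hβ.ne'] at h; exact hαβ h
      have e5 := congrArg Real.log e3
      rw [Real.log_rpow (by positivity), Real.log_rpow (by positivity)] at e5
      have := mul_right_cancel₀ (Real.log_ne_zero_of_pos_of_ne_one (by positivity) e4) e5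
      linarith
    have hY : Y = 0 := by
      rw [hX] at hs
      have : Y * (β ^ s * Real.log β) = 0 := by linarith
      exact (mul_eq_zero.1 this).resolve_right (mul_ne_zero (pb s).ne' hlb)
    rw [hX, hY] at ha; linarith

open Polynomial in
theorem aux_conj (x : ℝ) (hx : Irrational x) (e f : ℚ) (h : x ^ 2 = e * x + f)
    (P : ℚ[X]) (hP : aeval x P = 0) : aeval ((e : ℝ) - x) P = 0 := by
  obtain ⟨Q, hQ⟩ : ∃ Q : ℚ[X], Q = X ^ 2 - C e * X - C f := ⟨_, rfl⟩
  have hQm : Q.Monic := by rw [hQ]; monicity!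
  have hQn : Q.natDegree = 2 := by rw [hQ]; compute_degree!
  have hQx : aeval x Q = 0 := by simp [hQ, h]
  have hQx' : aeval ((e:ℝ) - x) Q = 0 := by simp [hQ]; linear_combination h
  have hdiv := modByMonic_add_div P Q
  have hdeg : (P %ₘ Q).natDegree ≤ 1 := by
    have := natDegree_modByMonic_lt P hQm (by intro h; rw [h] at hQn; simp at hQn)
    omega
  obtain ⟨a, b, hab⟩ := exists_eq_X_add_C_of_natDegree_le_one hdeg
  rw [hab] at hdiv
  rw [← hdiv] at hP ⊢
  simp only [map_add, map_mul, hQx, hQx', zero_mul, add_zero, aeval_C, aeval_X, eq_ratCast] at hP ⊢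
  have ha : a = 0 := by
    by_contra ha
    have ha' : (a : ℝ) ≠ 0 := by exact_mod_cast ha
    exact hx ⟨-b / a, by push_cast; field_simp; linarith⟩
  rw [ha] at hP ⊢
  simpa using hP

/-- Given three members `a<b<c` of the same parity, contradiction. -/
theorem aux_three (R S T X X' : ℝ) (hR : 0 < R) (hS : 0 < S) (hT : T ≠ 0) (hSR : S ≠ R)
    (hTR : |T| ≠ R) (hX : X ≠ X') (a b c : ℕ) (hab : a < b) (hbc : b < c)
    (hab2 : a % 2 = b % 2) (hbc2 : b % 2 = c % 2)
    (h : ∀ n, n = a ∨ n = b ∨ n = c → X * (S ^ n - R ^ n) = X' * (T ^ n - R ^ n)) : False := by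
  obtain ⟨ε, hε⟩ : ∃ ε : ℝ, ∀ n, n = a ∨ n = b ∨ n = c → T ^ n = ε * |T| ^ n := by
    rcases Nat.mod_two_eq_zero_or_one a with h0 | h0
    · refine ⟨1, fun n hn => ?_⟩
      have : Even n := by rw [Nat.even_iff]; omega
      rw [this.pow_abs, one_mul]
    · by_cases hT0 : 0 ≤ T
      · exact ⟨1, fun n _ => by rw [abs_of_nonneg hT0, one_mul]⟩
      · refine ⟨-1, fun n hn => ?_⟩
        have : Odd n := by rw [Nat.odd_iff]; omega
        rw [abs_of_neg (not_le.1 hT0), this.neg_pow]; ring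
  have key : ∀ n, n = a ∨ n = b ∨ n = c →
      X * (S / R) ^ n + (-X' * ε) * (|T| / R) ^ n + (X' - X) = 0 := by
    intro n hn
    have h1 := h n hn
    rw [hε n hn] at h1
    have : R ^ n ≠ 0 := by positivity
    rw [div_pow, div_pow]
    field_simp
    linear_combination h1
  have := aux_expo (S / R) (|T| / R) X (-X' * ε) (X' - X) (by positivity) (by positivity)
    (by rw [Ne, div_eq_one_iff_eq hR.ne']; exact hSR)
    (by rw [Ne, div_eq_one_iff_eq hR.ne']; exact hTR) a b c hab hbc
    (key a (by simp)) (key b (by simp)) (key c (by simp))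
  exact hX (by linarith)

/-- `z = (x,y)` rational with `A^m z` rational. -/
def LRat (R S C : ℝ) (m : ℕ) (x y : ℚ) : Prop :=
  ∃ u w : ℚ, R ^ m * x = u ∧ S ^ m * (y - C * x) = w - C * u

theorem aux_final (R S C : ℝ) (hR : 1 < R) (hS : 1 < S) (hRS : R ≠ S) (hC : Irrational C)
    (x₁ y₁ : ℚ) (hx₁ : x₁ ≠ 0) (h1 : LRat R S C 1 x₁ y₁)
    (x₂ y₂ : ℚ) (hx₂ : x₂ ≠ 0) (h2 : LRat R S C 2 x₂ y₂)
    (x y : ℚ) (hx : x ≠ 0) (n₁ n₂ n₃ n₄ : ℕ) (h0 : 0 < n₁) (h12 : n₁ < n₂) (h23 : n₂ < n₃)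
    (h34 : n₃ < n₄) (H : ∀ n, n = n₁ ∨ n = n₂ ∨ n = n₃ ∨ n = n₄ → LRat R S C n x y) : False := by
  have irr : ∀ x y : ℚ, x ≠ 0 → (y : ℝ) - C * x ≠ 0 := by
    intro x y hx h
    have hx' : (x : ℝ) ≠ 0 := by exact_mod_cast hx
    exact hC ⟨y / x, by push_cast; field_simp; linarith⟩
  -- R rational
  obtain ⟨u₁, w₁, hu₁, hw₁⟩ := h1
  obtain ⟨u₂, w₂, hu₂, hw₂⟩ := h2
  have hx₁' : (x₁ : ℝ) ≠ 0 := by exact_mod_cast hx₁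
  have hx₂' : (x₂ : ℝ) ≠ 0 := by exact_mod_cast hx₂
  have hx' : (x : ℝ) ≠ 0 := by exact_mod_cast hx
  obtain ⟨r, rfl⟩ : ∃ r : ℚ, (r : ℝ) = R := ⟨u₁ / x₁, by push_cast; field_simp; linarith⟩
  set θ : ℝ := S - r with hθ
  have hθ0 : θ ≠ 0 := sub_ne_zero.2 (Ne.symm hRS)
  -- relation 1
  set q₁ : ℚ := w₁ - r * y₁ with hq₁
  have r1 : θ * (y₁ - C * x₁) = q₁ := by
    simp only [hq₁, hθ]; push_cast
    rw [← hu₁] at hw₁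
    linear_combination hw₁
  have q1ne : (q₁ : ℝ) ≠ 0 := r1 ▸ mul_ne_zero hθ0 (irr _ _ hx₁)
  set α : ℚ := y₁ / x₁ with hα
  set β : ℚ := - q₁ / x₁ with hβ
  have hβ0 : (β : ℝ) ≠ 0 := by simp only [hβ]; push_cast; exact div_ne_zero (neg_ne_zero.2 q1ne) hx₁'
  have hCe : C = α + β / θ := by
    simp only [hα, hβ]; push_cast; field_simp; linear_combination -r1
  have hθirr : Irrational θ := by
    rintro ⟨t, ht⟩
    exact hC ⟨α + β / t, by push_cast; rw [ht]; exact hCe.symm⟩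
  -- general relation
  have gen : ∀ n (x y : ℚ), LRat r S C n x y →
      ∃ q : ℚ, (S ^ n - (r : ℝ) ^ n) * ((y - α * x) * θ - β * x) = q * θ := by
    rintro n x y ⟨u, w, hu, hw⟩
    refine ⟨w - r ^ n * y, ?_⟩
    rw [← hu, hCe] at hw
    push_cast
    field_simp at hw
    linear_combination hw
  obtain ⟨q₂, hq₂⟩ := gen 2 x₂ y₂ ⟨u₂, w₂, hu₂, hw₂⟩
  have hSθ : S = θ + r := by rw [hθ]; ring
  have r2 : (θ + 2 * r) * ((y₂ - α * x₂) * θ - β * x₂) = q₂ := by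
    rw [hSθ] at hq₂
    apply mul_right_cancel₀ hθ0
    linear_combination hq₂
  have hB : y₂ - α * x₂ ≠ 0 := by
    intro hB
    have hB' : (y₂ : ℝ) - α * x₂ = 0 := by exact_mod_cast hB
    rw [hB'] at r2
    have : θ = ((- q₂ / (β * x₂) - 2 * r : ℚ) : ℝ) := by
      push_cast; field_simp; linear_combination -r2
    exact hθirr ⟨_, this.symm⟩
  set B : ℚ := y₂ - α * x₂ with hBdef
  have hB' : (B : ℝ) ≠ 0 := by exact_mod_cast hB
  have hBc : (y₂ : ℝ) - α * x₂ = B := by simp [hBdef]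
  rw [hBc] at r2
  set e : ℚ := (β * x₂ - 2 * r * B) / B with he
  set f : ℚ := (q₂ + 2 * r * β * x₂) / B with hf
  have quad : θ ^ 2 = e * θ + f := by
    simp only [he, hf]; push_cast; field_simp; linear_combination r2
  set θ' : ℝ := e - θ with hθ'
  have hθ'irr : Irrational θ' := by
    rw [hθ']; exact hθirr.ratCast_sub e
  have hθ'0 : θ' ≠ 0 := hθ'irr.ne_zero
  have hne : θ ≠ θ' := by
    intro h
    refine hθirr ⟨e / 2, ?_⟩
    push_cast; linarith
  set T : ℝ := θ' + r with hT
  have hTirr : Irrational T := hθ'irr.add_ratCast r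
  have key : ∀ n, LRat r S C n x y →
     ((y - α * x) - β * x / θ) * (S ^ n - (r:ℝ) ^ n) = ((y - α * x) - β * x / θ') * (T ^ n - (r:ℝ) ^ n) := by
    intro n hn
    obtain ⟨q, hq⟩ := gen n x y hn
    have := aux_conj θ hθirr e f quad
      (((Polynomial.X + Polynomial.C r) ^ n - Polynomial.C (r ^ n)) * (Polynomial.C (y - α * x) *
        Polynomial.X - Polynomial.C (β * x)) - Polynomial.C q * Polynomial.X) (by
        simp; rw [← hSθ]; linear_combination hq)
    simp at this
    rw [← hθ', ← hT] at this
    have e1 : ((y - α * x) - β * x / θ) * (S ^ n - (r:ℝ) ^ n) = q := by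
      field_simp; linear_combination hq
    have e2 : ((y - α * x) - β * x / θ') * (T ^ n - (r:ℝ) ^ n) = q := by
      field_simp; linear_combination this
    rw [e1, e2]
  have hXX : ((y - α * x) - β * x / θ : ℝ) ≠ ((y - α * x) - β * x / θ') := by
    intro h
    have : (β * x : ℝ) * (θ' - θ) = 0 := by field_simp at h; linear_combination -h
    rcases mul_eq_zero.1 this with h | h
    · exact mul_ne_zero hβ0 hx' h
    · exact hne (by linarith)
  have hTR : |T| ≠ r := by
    intro h
    rcases abs_choice T with h' | h'
    · exact hTirr ⟨r, by rw [← h, h']⟩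
    · exact hTirr ⟨-r, by push_cast; rw [← h, h']; ring⟩
  have key0 := key 0 ⟨x, y, by simp, by simp⟩
  have fin : ∀ a b c : ℕ, a < b → b < c → a % 2 = b % 2 → b % 2 = c % 2 →
      (∀ n, n = a ∨ n = b ∨ n = c → LRat r S C n x y) → False := fun a b c hab hbc h1 h2 hh =>
    aux_three r S T _ _ (by linarith) (by linarith) hTirr.ne_zero (Ne.symm hRS) hTR hXX a b c hab hbc
      h1 h2 (fun n hn => key n (hh n hn))
  have L0 : LRat r S C 0 x y := ⟨x, y, by simp, by simp⟩
  have L1 := H n₁ (by simp)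
  have L2 := H n₂ (by simp)
  have L3 := H n₃ (by simp)
  have L4 := H n₄ (by simp)
  have fin' : ∀ a b c : ℕ, a < b → b < c → LRat r S C a x y → LRat r S C b x y →
      LRat r S C c x y → ¬ (a % 2 = b % 2 ∧ b % 2 = c % 2) := by
    rintro a b c hab hbc ha hb hc ⟨e1, e2⟩
    refine fin a b c hab hbc e1 e2 ?_
    rintro n (rfl | rfl | rfl) <;> assumption
  have f1 := fin' 0 n₁ n₂ h0 h12 L0 L1 L2
  have f2 := fin' 0 n₁ n₃ h0 (by omega) L0 L1 L3
  have f3 := fin' 0 n₁ n₄ h0 (by omega) L0 L1 L4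
  have f4 := fin' 0 n₂ n₃ (by omega) (by omega) L0 L2 L3
  have f5 := fin' 0 n₂ n₄ (by omega) (by omega) L0 L2 L4
  have f6 := fin' 0 n₃ n₄ (by omega) (by omega) L0 L3 L4
  have f7 := fin' n₁ n₂ n₃ (by omega) (by omega) L1 L2 L3
  have f8 := fin' n₁ n₂ n₄ (by omega) (by omega) L1 L2 L4
  have f9 := fin' n₁ n₃ n₄ (by omega) (by omega) L1 L3 L4
  have f10 := fin' n₂ n₃ n₄ (by omega) (by omega) L2 L3 L4
  omega


theorem aux_val (p : ℕ) (hp : p.Prime) : ∃ V : ValuationSubring ℝ, V.valuation (p : ℝ) < 1 := by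
  let A : Subring ℝ := (Int.castRingHom ℝ).range
  let pp : A := ⟨(p : ℝ), ⟨(p : ℤ), by simp⟩⟩
  have hI : Ideal.span {pp} ≠ ⊤ := by
    rw [Ne, Ideal.span_singleton_eq_top]
    intro h
    obtain ⟨⟨b, n, hn⟩, hb⟩ := isUnit_iff_exists_inv.1 h
    have h1 : (p : ℝ) * b = 1 := congrArg Subtype.val hb
    rw [← hn] at h1
    have h2 : (p : ℤ) * n = 1 := by
      have : ((p : ℤ) : ℝ) * (n : ℝ) = 1 := by simpa using h1
      exact_mod_cast this
    have := Int.isUnit_iff.1 (IsUnit.of_mul_eq_one _ h2)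
    have := hp.two_le
    omega
  obtain ⟨V, _, hV⟩ := Ideal.image_subset_nonunits_valuationSubring _ hI
  refine ⟨V, ?_⟩
  have : (p : ℝ) ∈ V.nonunits := hV ⟨pp, Ideal.mem_span_singleton_self _, rfl⟩
  exact this

theorem aux_val_int_le (V : ValuationSubring ℝ) (n : ℤ) : V.valuation (n : ℝ) ≤ 1 :=
  (V.valuation_le_one_iff _).2 (intCast_mem V n)

theorem aux_val_int (V : ValuationSubring ℝ) (p : ℕ) (hp : p.Prime) (hV : V.valuation (p : ℝ) < 1)
    (n : ℤ) (hn : ¬ (p : ℤ) ∣ n) : V.valuation (n : ℝ) = 1 := by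
  refine le_antisymm (aux_val_int_le V n) ?_
  have hco : IsCoprime (p : ℤ) n := by
    rw [(Nat.prime_iff_prime_int.1 hp).irreducible.coprime_iff_not_dvd]; exact hn
  obtain ⟨s, t, hst⟩ := hco
  have h1 : (s : ℝ) * p + t * n = 1 := by exact_mod_cast hst
  by_contra hlt
  push Not at hlt
  have h2 : V.valuation ((s : ℝ) * p) < 1 := by
    rw [map_mul]; exact by rw [mul_comm]; exact mul_lt_one_of_lt_of_le hV (aux_val_int_le V s)
  have h3 : V.valuation ((t : ℝ) * n) < 1 := by
    rw [map_mul]; exact by rw [mul_comm]; exact mul_lt_one_of_lt_of_le hlt (aux_val_int_le V t)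
  have h4 := V.valuation.map_add_lt h2 h3
  rw [h1, map_one] at h4
  exact lt_irrefl _ h4

theorem aux_ring (V : ValuationSubring ℝ) (p : ℕ) (hp : p.Prime) (hV : V.valuation (p : ℝ) < 1)
    (R : ℝ) (hR1 : V.valuation R = 1) :
    ∃ (K : Type) (_ : Field K) (_ : Finite K) (φ : Algebra.adjoin ℤ ({R, R⁻¹} : Set ℝ) →+* K),
      φ (p : Algebra.adjoin ℤ ({R, R⁻¹} : Set ℝ)) = 0 := by
  set O := Algebra.adjoin ℤ ({R, R⁻¹} : Set ℝ) with hO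
  have hOV : ∀ g ∈ O, V.valuation g ≤ 1 := by
    intro g hg
    induction hg using Algebra.adjoin_induction with
    | mem x hx =>
      rcases hx with rfl | rfl
      · exact hR1.le
      · simp [hR1]
    | algebraMap r => exact aux_val_int_le V r
    | add x y _ _ hx hy => exact V.valuation.map_add_le hx hy
    | mul x y _ _ hx hy => rw [map_mul]; exact mul_le_one' hx hy
  have hI : Ideal.span {(p : O)} ≠ ⊤ := by
    rw [Ne, Ideal.span_singleton_eq_top]
    intro h
    obtain ⟨b, hb⟩ := isUnit_iff_exists_inv.1 h
    have h1 : (p : ℝ) * (b : ℝ) = 1 := by simpa using congrArg Subtype.val hb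
    have h2 := congrArg V.valuation h1
    rw [map_mul, map_one] at h2
    have := mul_lt_one_of_lt_of_le hV (hOV b b.2)
    rw [h2] at this
    exact lt_irrefl _ this
  obtain ⟨m, hm, hle⟩ := Ideal.exists_le_maximal _ hI
  let : Field (O ⧸ m) := Ideal.Quotient.field m
  have hp0 : Ideal.Quotient.mk m (p : O) = 0 :=
    Ideal.Quotient.eq_zero_iff_mem.2 (hle (Ideal.mem_span_singleton_self _))
  have ft : Algebra.FiniteType ℤ O := by
    rw [← Subalgebra.fg_iff_finiteType]
    exact ⟨{R, R⁻¹}, by simp [hO]⟩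
  have ft2 : Algebra.FiniteType ℤ (O ⧸ m) :=
    Algebra.FiniteType.of_surjective (Ideal.Quotient.mkₐ ℤ m) (Ideal.Quotient.mkₐ_surjective ℤ m)
  have : Fact p.Prime := ⟨hp⟩
  have : CharP (O ⧸ m) p := by
    have h0 : (p : O ⧸ m) = 0 := by simpa using hp0
    exact (CharP.charP_iff_prime_eq_zero hp).2 h0
  let : Algebra (ZMod p) (O ⧸ m) := ZMod.algebra _ p
  have fin2 : Module.Finite (ZMod p) (O ⧸ m) := by
    have ft3 : Algebra.FiniteType (ZMod p) (O ⧸ m) :=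
      Algebra.FiniteType.of_restrictScalars_finiteType ℤ (ZMod p) _
    exact finite_of_finite_type_of_isJacobsonRing _ _
  have fin3 : Finite (O ⧸ m) := Module.finite_of_finite (ZMod p)
  exact ⟨O ⧸ m, inferInstance, fin3, Ideal.Quotient.mk m, hp0⟩

def GoodP (p : ℕ) (a : Fin 2 → ℤ) (x y : ℚ) : Prop :=
  ∃ j : ℕ, 1 ≤ j ∧ j ≤ p - 1 ∧ ∃ n m : ℤ, x = j * a 0 / p + n ∧ y = j * a 1 / p + m

def LevZ (R S C : ℝ) (k : ℕ) (x y : ℚ) (ξ : Fin 2 → ℝ) : Prop :=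
  ξ 0 = R ^ k * x ∧ ξ 1 - C * ξ 0 = S ^ k * (y - C * x)

def Lev (p : ℕ) (a : Fin 2 → ℤ) (R S C : ℝ) (k : ℕ) (ξ : Fin 2 → ℝ) : Prop :=
  ∃ x y, GoodP p a x y ∧ LevZ R S C k x y ξ

theorem good_int (p : ℕ) (hp : p.Prime) (a : Fin 2 → ℤ) (ha : ∀ i, 1 ≤ a i ∧ a i ≤ (p : ℤ) - 1)
    (x y : ℚ) (h : GoodP p a x y) : ∃ N : ℤ, ¬ (p : ℤ) ∣ N ∧ (x : ℝ) * p = N := by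
  obtain ⟨j, h1, h2, n, m, rfl, -⟩ := h
  have hp0 : (p : ℝ) ≠ 0 := by exact_mod_cast hp.ne_zero
  have hpp := hp.two_le
  refine ⟨j * a 0 + p * n, ?_, by push_cast; field_simp⟩
  rw [Int.dvd_add_left (dvd_mul_right _ _)]
  intro h
  rcases (Nat.prime_iff_prime_int.1 hp).dvd_or_dvd h with h | h
  · have := Int.le_of_dvd (by omega) h; omega
  · have := Int.le_of_dvd (by have := (ha 0).1; omega) h; have := (ha 0).2; omega

theorem good_ne (p : ℕ) (hp : p.Prime) (a : Fin 2 → ℤ) (ha : ∀ i, 1 ≤ a i ∧ a i ≤ (p : ℤ) - 1)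
    (x y : ℚ) (h : GoodP p a x y) : x ≠ 0 := by
  rintro rfl
  obtain ⟨N, hN, h⟩ := good_int p hp a ha 0 y h
  have : N = 0 := by
    have : (N : ℝ) = 0 := by rw [← h]; simp
    exact_mod_cast this
  exact hN (this ▸ dvd_zero _)

theorem lev_val (V : ValuationSubring ℝ) (p : ℕ) (hp : p.Prime) (hV : V.valuation (p : ℝ) < 1)
    (a : Fin 2 → ℤ) (ha : ∀ i, 1 ≤ a i ∧ a i ≤ (p : ℤ) - 1) (R S C : ℝ) (k : ℕ) (ξ : Fin 2 → ℝ)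
    (h : Lev p a R S C k ξ) :
    V.valuation (ξ 0) = V.valuation R ^ k * (V.valuation (p : ℝ))⁻¹ := by
  obtain ⟨x, y, hg, h0, -⟩ := h
  obtain ⟨N, hN, hx⟩ := good_int p hp a ha x y hg
  have hp0 : (p : ℝ) ≠ 0 := by exact_mod_cast hp.ne_zero
  have : (x : ℝ) = N * (p : ℝ)⁻¹ := by field_simp; exact hx
  rw [h0, this, map_mul, map_mul, map_pow, map_inv₀, aux_val_int V p hp hV N hN, one_mul]

/-- unit case -/
theorem case_eq (V : ValuationSubring ℝ) (p : ℕ) (hp : p.Prime) (hV : V.valuation (p : ℝ) < 1)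
    (a : Fin 2 → ℤ) (ha : ∀ i, 1 ≤ a i ∧ a i ≤ (p : ℤ) - 1) (R S C : ℝ) (hR : 1 < R)
    (Λ : Set (Fin 2 → ℝ))
    (H1 : ∀ l ∈ Λ, ∀ l' ∈ Λ, l ≠ l' → ∃ k, Lev p a R S C k (l - l'))
    (hR1 : V.valuation R = 1) : Λ.Finite := by
  obtain ⟨K, _, _, φ, hφ⟩ := aux_ring V p hp hV R hR1
  set O := Algebra.adjoin ℤ ({R, R⁻¹} : Set ℝ) with hO
  have hRO : R ∈ O := Algebra.subset_adjoin (by simp)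
  have hRO' : R⁻¹ ∈ O := Algebra.subset_adjoin (by simp)
  rcases Λ.eq_empty_or_nonempty with rfl | ⟨b, hb⟩
  · exact Set.finite_empty
  have key : ∀ l ∈ Λ, ∀ l' ∈ Λ, l ≠ l' →
      ∃ h : (l 0 - l' 0) * p ∈ O, φ ⟨(l 0 - l' 0) * p, h⟩ ≠ 0 := by
    intro l hl l' hl' hne
    obtain ⟨k, x, y, hg, h0, -⟩ := H1 l hl l' hl' hne
    obtain ⟨N, hN, hx⟩ := good_int p hp a ha x y hg
    have e : (l 0 - l' 0) * p = (((⟨R, hRO⟩ : O) ^ k * (N : O) : O) : ℝ) := by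
      have h0' : l 0 - l' 0 = R ^ k * x := h0
      rw [h0', mul_assoc, hx]; simp
    refine ⟨e ▸ Subtype.coe_prop _, ?_⟩
    have e2 : (⟨(l 0 - l' 0) * p, e ▸ Subtype.coe_prop _⟩ : O) = (⟨R, hRO⟩ : O) ^ k * (N : O) :=
      Subtype.ext e
    rw [e2, map_mul, map_pow]
    refine mul_ne_zero (pow_ne_zero _ ?_) ?_
    · intro h
      have : (⟨R, hRO⟩ : O) * ⟨R⁻¹, hRO'⟩ = 1 := Subtype.ext (mul_inv_cancel₀ (by positivity))
      have := congrArg φ this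
      rw [map_mul, h, zero_mul, map_one] at this
      exact zero_ne_one this
    · rw [map_intCast]
      intro h
      have hc : CharP K p := (CharP.charP_iff_prime_eq_zero hp).2 (by simpa using hφ)
      exact hN ((CharP.intCast_eq_zero_iff K p N).1 h)
  have hmem : ∀ l ∈ Λ, (l 0 - b 0) * p ∈ O := by
    intro l hl
    by_cases h : l = b
    · subst h; simp
    · exact (key l hl b hb h).1
  let F : Λ → K := fun l => φ ⟨(l.1 0 - b 0) * p, hmem l.1 l.2⟩
  have hF : Function.Injective F := by
    rintro ⟨l, hl⟩ ⟨l', hl'⟩ h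
    by_contra hne
    obtain ⟨h1, h2⟩ := key l hl l' hl' (fun h => hne (Subtype.ext h))
    apply h2
    have : (⟨(l 0 - l' 0) * p, h1⟩ : O) =
        ⟨(l 0 - b 0) * p, hmem l hl⟩ - ⟨(l' 0 - b 0) * p, hmem l' hl'⟩ := by
      apply Subtype.ext
      show _ = (l 0 - b 0) * (p : ℝ) - (l' 0 - b 0) * p
      simp only; ring
    rw [this, map_sub]
    exact sub_eq_zero.2 h
  have : Finite Λ := Finite.of_injective F hF
  exact Set.toFinite Λ


theorem lev_lt (V : ValuationSubring ℝ) (p : ℕ) (hp : p.Prime) (hV : V.valuation (p : ℝ) < 1) :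
    0 < (V.valuation (p : ℝ))⁻¹ ∧ 1 < (V.valuation (p : ℝ))⁻¹ := by
  have h0 : 0 < V.valuation (p : ℝ) := by
    rw [Valuation.pos_iff]; exact_mod_cast hp.ne_zero
  exact ⟨inv_pos.2 h0, (one_lt_inv₀ h0).2 hV⟩

theorem case_gt (V : ValuationSubring ℝ) (p : ℕ) (hp : p.Prime) (hV : V.valuation (p : ℝ) < 1)
    (a : Fin 2 → ℤ) (ha : ∀ i, 1 ≤ a i ∧ a i ≤ (p : ℤ) - 1) (R S C : ℝ) (hR : 1 < R)
    (Λ : Set (Fin 2 → ℝ))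
    (H1 : ∀ l ∈ Λ, ∀ l' ∈ Λ, l ≠ l' → ∃ k, Lev p a R S C k (l - l'))
    (H2 : ∀ K, 1 ≤ K → ∃ l ∈ Λ, ∃ l' ∈ Λ, l ≠ l' ∧ Lev p a R S C K (l - l'))
    (hr : 1 < V.valuation R) : False := by
  obtain ⟨hP0, hP1⟩ := lev_lt V p hp hV
  have hval := lev_val V p hp hV a ha R S C
  set P := (V.valuation (p : ℝ))⁻¹ with hPdef
  set v := V.valuation with hv
  have hpR : (0 : ℝ) < p := by exact_mod_cast hp.pos
  have hmono : StrictMono (fun k : ℕ => v R ^ k * P) := by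
    intro i j hij
    exact mul_lt_mul_of_pos_right (pow_lt_pow_right₀ hr hij) hP0
  obtain ⟨l0, hl0, l1, hl1, hne, k1, x, y, hg, hx, hy⟩ :
      ∃ l ∈ Λ, ∃ l' ∈ Λ, l ≠ l' ∧ ∃ k, Lev p a R S C k (l - l') := by
    obtain ⟨l, hl, l', hl', h, h'⟩ := H2 1 le_rfl
    exact ⟨l, hl, l', hl', h, 1, h'⟩
  have hlev1 := hval k1 (l0 - l1) ⟨x, y, hg, hx, hy⟩
  obtain ⟨K0, hK0⟩ := pow_unbounded_of_one_lt (R ^ k1 * |(x : ℝ)| * p) hR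
  set K := max K0 (k1 + 1) with hK
  have hRK : R ^ k1 * |(x : ℝ)| * p < R ^ K :=
    hK0.trans_le (pow_le_pow_right₀ hR.le (le_max_left _ _))
  obtain ⟨b, hb, d, hd, hbd, hLev⟩ := H2 K (by omega)
  have hvbd := hval K _ hLev
  obtain ⟨e, he, hve⟩ : ∃ e ∈ Λ, v R ^ K * P ≤ v (e 0 - l0 0) := by
    by_contra hcon
    push Not at hcon
    have := v.map_sub_lt (hcon b hb) (hcon d hd)
    rw [sub_sub_sub_cancel_right] at this
    have h2 : v (b 0 - d 0) = v R ^ K * P := hvbd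
    rw [h2] at this
    exact lt_irrefl _ this
  have hlt : v (l0 0 - l1 0) < v (e 0 - l0 0) := by
    refine lt_of_lt_of_le ?_ hve
    have h2 : v (l0 0 - l1 0) = _ := hlev1
    rw [h2]
    exact hmono (by omega)
  have hve1 : v (e 0 - l1 0) = v (e 0 - l0 0) := by
    have : e 0 - l1 0 = (e 0 - l0 0) + (l0 0 - l1 0) := by ring
    rw [this, v.map_add_eq_of_lt_left hlt]
  have hpos : 0 < v (e 0 - l0 0) := lt_of_le_of_lt zero_le hlt
  have hne0 : e ≠ l0 := by rintro rfl; simp at hpos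
  have hne1 : e ≠ l1 := by rintro rfl; rw [← hve1] at hpos; simp at hpos
  obtain ⟨m, x', y', hg', hx', hy'⟩ := H1 e he l0 hl0 hne0
  obtain ⟨m', x'', y'', hg'', hx'', hy''⟩ := H1 e he l1 hl1 hne1
  have e1 : v (e 0 - l0 0) = _ := hval m _ ⟨x', y', hg', hx', hy'⟩
  have e2 : v (e 0 - l1 0) = _ := hval m' _ ⟨x'', y'', hg'', hx'', hy''⟩
  have hmm : m = m' := hmono.injective (by show _ * _ = _ * _; rw [← e1, ← e2, hve1])
  subst hmm
  have hKm : K ≤ m := by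
    rw [e1] at hve
    exact hmono.le_iff_le.1 hve
  obtain ⟨N, hN, hxN⟩ := good_int p hp a ha x y hg
  obtain ⟨N', hN', hxN'⟩ := good_int p hp a ha x' y' hg'
  obtain ⟨N'', hN'', hxN''⟩ := good_int p hp a ha x'' y'' hg''
  have eqn : R ^ k1 * ((x : ℝ) * p) = R ^ m * ((N'' - N' : ℤ) : ℝ) := by
    push_cast
    rw [← hxN', ← hxN'']
    simp only [Pi.sub_apply] at hx hx' hx''
    linear_combination (p : ℝ) * (-hx + hx'' - hx')
  have hxne : (x : ℝ) ≠ 0 := by exact_mod_cast good_ne p hp a ha x y hg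
  have hNne : N'' - N' ≠ 0 := by
    intro h
    rw [h] at eqn
    have : R ^ k1 * ((x : ℝ) * p) ≠ 0 := by positivity
    exact this (by simpa using eqn)
  have hN1 : (1 : ℝ) ≤ |((N'' - N' : ℤ) : ℝ)| := by
    exact_mod_cast Int.one_le_abs hNne
  have h3 := congrArg abs eqn
  rw [abs_mul, abs_mul, abs_mul, abs_of_pos (show 0 < R ^ k1 by positivity),
    abs_of_pos (show 0 < R ^ m by positivity), abs_of_pos hpR] at h3
  have h4 : R ^ K ≤ R ^ m := pow_le_pow_right₀ hR.le hKm
  have h5 : R ^ m ≤ R ^ m * |((N'' - N' : ℤ) : ℝ)| :=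
    le_mul_of_one_le_right (by positivity) hN1
  linarith

theorem aux_core (V : ValuationSubring ℝ) (p : ℕ) (hp : p.Prime) (hV : V.valuation (p : ℝ) < 1)
    (a : Fin 2 → ℤ) (ha : ∀ i, 1 ≤ a i ∧ a i ≤ (p : ℤ) - 1) (R S C : ℝ) (hR : 1 < R) (hS : 1 < S)
    (Λ : Set (Fin 2 → ℝ)) (k : ℕ)
    (H1 : ∀ l ∈ Λ, ∀ l' ∈ Λ, l ≠ l' → ∃ m, k ≤ m ∧ Lev p a R S C m (l - l'))
    (hr : V.valuation R < 1)
    (c d : Fin 2 → ℝ) (hc : c ∈ Λ) (hd : d ∈ Λ) (hcd : Lev p a R S C k (c - d))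
    (s t : Fin 2 → ℝ) (hs : s ∈ Λ) (ht : t ∈ Λ)
    (hst : V.valuation (s 0 - t 0) < V.valuation R ^ k * (V.valuation (p : ℝ))⁻¹)
    (n : ℕ) (x y : ℚ) (hg : GoodP p a x y) (hl : LevZ R S C n x y (s - t)) :
    k < n ∧ LRat R S C (n - k) x y := by
  obtain ⟨hP0, hP1⟩ := lev_lt V p hp hV
  have hval := lev_val V p hp hV a ha R S C
  set P := (V.valuation (p : ℝ))⁻¹ with hPdef
  set v := V.valuation with hv
  have hr0 : 0 < v R := by rw [Valuation.pos_iff]; positivity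
  have hmono : StrictAnti (fun k : ℕ => v R ^ k * P) := by
    intro i j hij
    exact mul_lt_mul_of_pos_right (pow_lt_pow_right_of_lt_one₀ hr0 hr hij) hP0
  have hkn : k < n := by
    have : v (s 0 - t 0) = _ := hval n _ ⟨x, y, hg, hl⟩
    rw [this] at hst
    exact hmono.lt_iff_gt.1 hst
  refine ⟨hkn, ?_⟩
  have hle : ∀ l ∈ Λ, ∀ l' ∈ Λ, v (l 0 - l' 0) ≤ v R ^ k * P := by
    intro l hl l' hl'
    by_cases h : l = l'
    · rw [h]; simp
    · obtain ⟨m, hm, hL⟩ := H1 l hl l' hl' h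
      have : v (l 0 - l' 0) = _ := hval m _ hL
      rw [this]
      exact hmono.antitone hm
  obtain ⟨e, he, hve⟩ : ∃ e ∈ Λ, v (s 0 - e 0) = v R ^ k * P := by
    by_contra hcon
    push Not at hcon
    have h1 := lt_of_le_of_ne (hle s hs c hc) (hcon c hc)
    have h2 := lt_of_le_of_ne (hle s hs d hd) (hcon d hd)
    have := v.map_sub_lt h2 h1
    rw [sub_sub_sub_cancel_left] at this
    have h3 : v (c 0 - d 0) = _ := hval k _ hcd
    rw [h3] at this
    exact lt_irrefl _ this
  have hvt : v (t 0 - e 0) = v R ^ k * P := by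
    have : t 0 - e 0 = (s 0 - e 0) - (s 0 - t 0) := by ring
    rw [this, v.map_sub_eq_of_lt_left (by rw [hve]; exact hst), hve]
  have hpos : 0 < v R ^ k * P := lt_of_le_of_lt zero_le hst
  have get : ∀ l ∈ Λ, v (l 0 - e 0) = v R ^ k * P → Lev p a R S C k (l - e) := by
    intro l hl hvl
    have hne : l ≠ e := by rintro rfl; rw [sub_self, map_zero] at hvl; exact hpos.ne hvl
    obtain ⟨m, hm, hL⟩ := H1 l hl e he hne
    have : v (l 0 - e 0) = _ := hval m _ hL
    have hkm : k = m := hmono.injective (by show _ * _ = _ * _; rw [← this, hvl])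
    rw [hkm]; exact hL
  obtain ⟨x1, y1, -, hx1, hy1⟩ := get s hs hve
  obtain ⟨x2, y2, -, hx2, hy2⟩ := get t ht hvt
  obtain ⟨hx, hy⟩ := hl
  simp only [Pi.sub_apply] at hx hy hx1 hy1 hx2 hy2
  obtain ⟨m, rfl⟩ : ∃ m, n = k + m := ⟨n - k, by omega⟩
  rw [Nat.add_sub_cancel_left]
  have hRk : R ^ k ≠ 0 := by positivity
  have hSk : S ^ k ≠ 0 := by positivity
  rw [pow_add] at hx hy
  refine ⟨x1 - x2, y1 - y2, ?_, ?_⟩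
  · push_cast
    apply mul_left_cancel₀ hRk
    linear_combination -hx + hx1 - hx2
  · push_cast
    apply mul_left_cancel₀ hSk
    linear_combination -hy + hy1 - hy2

theorem aux_descent (V : ValuationSubring ℝ) (p : ℕ) (hp : p.Prime) (hV : V.valuation (p : ℝ) < 1)
    (a : Fin 2 → ℤ) (ha : ∀ i, 1 ≤ a i ∧ a i ≤ (p : ℤ) - 1) (R S C : ℝ) (hR : 1 < R) (hS : 1 < S)
    (hr : V.valuation R < 1) (Λ : Set (Fin 2 → ℝ))
    (H1 : ∀ l ∈ Λ, ∀ l' ∈ Λ, l ≠ l' → ∃ m, Lev p a R S C m (l - l')) (hinf : Λ.Infinite) :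
    ∃ k : ℕ, ∃ Λ' ⊆ Λ, Λ'.Infinite ∧ (∃ s ∈ Λ, ∃ t ∈ Λ, s ≠ t ∧ Lev p a R S C k (s - t)) ∧
      ∀ s ∈ Λ', ∀ t ∈ Λ', s ≠ t → ∀ n x y,
        GoodP p a x y → LevZ R S C n x y (s - t) → k < n ∧ LRat R S C (n - k) x y := by
  classical
  have hex : ∃ k, ∃ s ∈ Λ, ∃ t ∈ Λ, s ≠ t ∧ Lev p a R S C k (s - t) := by
    obtain ⟨s, hs, t, ht, hne⟩ := hinf.nontrivial
    obtain ⟨m, hm⟩ := H1 s hs t ht hne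
    exact ⟨m, s, hs, t, ht, hne, hm⟩
  set k := Nat.find hex with hk
  obtain ⟨c, hc, d, hd, hcd, hLcd⟩ := Nat.find_spec hex
  rw [← hk] at hLcd
  have H1' : ∀ l ∈ Λ, ∀ l' ∈ Λ, l ≠ l' → ∃ m, k ≤ m ∧ Lev p a R S C m (l - l') := by
    intro l hl l' hl' hne
    obtain ⟨m, hm⟩ := H1 l hl l' hl' hne
    exact ⟨m, Nat.find_min' hex ⟨l, hl, l', hl', hne, hm⟩, hm⟩
  obtain ⟨hP0, hP1⟩ := lev_lt V p hp hV
  have hval := lev_val V p hp hV a ha R S C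
  have core := aux_core V p hp hV a ha R S C hR hS Λ k H1' hr c d hc hd hLcd
  set P := (V.valuation (p : ℝ))⁻¹ with hPdef
  set v := V.valuation with hv
  have hr0 : 0 < v R := by rw [Valuation.pos_iff]; positivity
  have hcls : ∀ l : Λ, ∃ j : Fin p, (v (l.1 0 - c 0) < v R ^ k * P ∧ (j : ℕ) = 0) ∨
      ((j : ℕ) ≠ 0 ∧ ∃ n : ℤ, l.1 0 - c 0 = R ^ k * ((j : ℕ) * a 0 / p + n)) := by
    rintro ⟨l, hl⟩
    by_cases hlt : v (l 0 - c 0) < v R ^ k * P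
    · exact ⟨⟨0, hp.pos⟩, Or.inl ⟨hlt, rfl⟩⟩
    · have hne : l ≠ c := by
        rintro rfl; apply hlt; simp; exact mul_pos (pow_pos hr0 _) hP0
      obtain ⟨m, hm, hL⟩ := H1' l hl c hc hne
      have hmk : m = k := by
        by_contra hmk
        apply hlt
        have : v (l 0 - c 0) = _ := hval m _ hL
        rw [this]
        exact mul_lt_mul_of_pos_right
          (pow_lt_pow_right_of_lt_one₀ hr0 hr (lt_of_le_of_ne hm (Ne.symm hmk))) hP0
      subst hmk
      obtain ⟨x, y, ⟨j, hj1, hj2, n, m', hxe, hye⟩, hx, hy⟩ := hL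
      have := hp.two_le
      refine ⟨⟨j, by omega⟩, Or.inr ⟨by simp; omega, n, ?_⟩⟩
      simp only [Pi.sub_apply] at hx
      rw [hx, hxe]; push_cast; rfl
  choose F hF using hcls
  have : Infinite Λ := hinf.to_subtype
  obtain ⟨j, hj⟩ := Finite.exists_infinite_fiber F
  refine ⟨k, Subtype.val '' (F ⁻¹' {j}), ?_, ?_, ⟨c, hc, d, hd, hcd, hLcd⟩, ?_⟩
  · rintro _ ⟨x, -, rfl⟩; exact x.2
  · exact (Set.infinite_coe_iff.1 hj).image Subtype.val_injective.injOn
  · rintro _ ⟨s, hs, rfl⟩ _ ⟨t, ht, rfl⟩ hne n x y hg hl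
    refine core s t s.2 t.2 ?_ n x y hg hl
    have hs' := hF s
    have ht' := hF t
    rw [show F s = j from hs] at hs'
    rw [show F t = j from ht] at ht'
    rcases hs' with ⟨hs1, hs2⟩ | ⟨hs1, n1, hs2⟩ <;> rcases ht' with ⟨ht1, ht2⟩ | ⟨ht1, n2, ht2⟩
    · have := v.map_sub_lt hs1 ht1
      rwa [sub_sub_sub_cancel_right] at this
    · exact absurd hs2 ht1
    · exact absurd ht2 hs1
    · have e : s.1 0 - t.1 0 = R ^ k * ((n1 - n2 : ℤ) : ℝ) := by
        push_cast; linear_combination hs2 - ht2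
      rw [e, map_mul, map_pow]
      refine mul_lt_mul_of_pos_left (lt_of_le_of_lt (aux_val_int_le V _) hP1) (pow_pos hr0 _)

theorem comb (p : ℕ) (hp : p.Prime)
    (a : Fin 2 → ℤ) (ha : ∀ i, 1 ≤ a i ∧ a i ≤ (p : ℤ) - 1) (R S C : ℝ) (hR : 1 < R) (hS : 1 < S)
    (hRS : R ≠ S) (hC : Irrational C)
    (Λ : Set (Fin 2 → ℝ))
    (H1 : ∀ l ∈ Λ, ∀ l' ∈ Λ, l ≠ l' → ∃ k, 1 ≤ k ∧ Lev p a R S C k (l - l'))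
    (H2 : ∀ K, 1 ≤ K → ∃ l ∈ Λ, ∃ l' ∈ Λ, l ≠ l' ∧ Lev p a R S C K (l - l') ∧
      ∀ k, 1 ≤ k → Lev p a R S C k (l - l') → k = K) : False := by
  have hinf : Λ.Infinite := by
    intro hfin
    choose s hs t ht hne hL hu using fun K : ℕ => H2 (K + 1) (by omega)
    have hfin2 := hfin.prod hfin
    have hinj : Function.Injective (fun K => (s K, t K)) := by
      intro K K' h
      simp only [Prod.mk.injEq] at h
      have h1 := hL K
      rw [h.1, h.2] at h1
      have := hu K' _ (by omega) h1
      omega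
    exact Set.infinite_of_injective_forall_mem hinj (fun K => Set.mk_mem_prod (hs K) (ht K)) hfin2
  have H1' : ∀ l ∈ Λ, ∀ l' ∈ Λ, l ≠ l' → ∃ k, Lev p a R S C k (l - l') := by
    intro l hl l' hl' hne
    obtain ⟨k, -, h⟩ := H1 l hl l' hl' hne
    exact ⟨k, h⟩
  obtain ⟨V, hV⟩ := aux_val p hp
  rcases lt_trichotomy (V.valuation R) 1 with hr | hr | hr
  · obtain ⟨c, hc, d, hd, hcd, hLcd, -⟩ := H2 1 le_rfl
    have core := aux_core V p hp hV a ha R S C hR hS Λ 1 H1 hr c d hc hd hLcd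
    obtain ⟨hP0, hP1⟩ := lev_lt V p hp hV
    have hr0 : 0 < V.valuation R := by rw [Valuation.pos_iff]; positivity
    have LL : ∀ K, 1 ≤ K → ∃ x y : ℚ, x ≠ 0 ∧ LRat R S C K x y := by
      intro K hK
      obtain ⟨s, hs, t, ht, hst, ⟨x, y, hg, hl⟩, -⟩ := H2 (K + 1) (by omega)
      have hv : V.valuation (s 0 - t 0) = _ :=
        lev_val V p hp hV a ha R S C (K + 1) _ ⟨x, y, hg, hl⟩
      have := core s t hs ht (by
        rw [hv]
        exact mul_lt_mul_of_pos_right (pow_lt_pow_right_of_lt_one₀ hr0 hr (by omega)) hP0)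
        (K + 1) x y hg hl
      exact ⟨x, y, good_ne p hp a ha x y hg, this.2⟩
    obtain ⟨x₁, y₁, hx₁, hl₁⟩ := LL 1 le_rfl
    obtain ⟨x₂, y₂, hx₂, hl₂⟩ := LL 2 (by omega)
    have desc := aux_descent V p hp hV a ha R S C hR hS hr
    obtain ⟨k1, Λ1, hs1, hi1, -, hd1⟩ := desc Λ H1' hinf
    have H11 : ∀ l ∈ Λ1, ∀ l' ∈ Λ1, l ≠ l' → ∃ k, Lev p a R S C k (l - l') :=
      fun l hl l' hl' => H1' l (hs1 hl) l' (hs1 hl')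
    obtain ⟨k2, Λ2, hs2, hi2, ⟨s2, hs2', t2, ht2, hne2, x2, y2, hg2, hL2⟩, hd2⟩ := desc Λ1 H11 hi1
    have H12 : ∀ l ∈ Λ2, ∀ l' ∈ Λ2, l ≠ l' → ∃ k, Lev p a R S C k (l - l') :=
      fun l hl l' hl' => H11 l (hs2 hl) l' (hs2 hl')
    obtain ⟨k3, Λ3, hs3, hi3, ⟨s3, hs3', t3, ht3, hne3, x3, y3, hg3, hL3⟩, hd3⟩ := desc Λ2 H12 hi2
    have H13 : ∀ l ∈ Λ3, ∀ l' ∈ Λ3, l ≠ l' → ∃ k, Lev p a R S C k (l - l') :=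
      fun l hl l' hl' => H12 l (hs3 hl) l' (hs3 hl')
    obtain ⟨k4, Λ4, hs4, hi4, ⟨s4, hs4', t4, ht4, hne4, x4, y4, hg4, hL4⟩, hd4⟩ := desc Λ3 H13 hi3
    have b1 := (hd1 s2 hs2' t2 ht2 hne2 k2 x2 y2 hg2 hL2).1
    have b2 := (hd2 s3 hs3' t3 ht3 hne3 k3 x3 y3 hg3 hL3).1
    have b3 := (hd3 s4 hs4' t4 ht4 hne4 k4 x4 y4 hg4 hL4).1
    obtain ⟨s, hs, t, ht, hne⟩ := hi4.nontrivial
    obtain ⟨n, x, y, hg, hL⟩ := H13 s (hs4 hs) t (hs4 ht) hne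
    have c4 := hd4 s hs t ht hne n x y hg hL
    have c3 := hd3 s (hs4 hs) t (hs4 ht) hne n x y hg hL
    have c2 := hd2 s (hs3 (hs4 hs)) t (hs3 (hs4 ht)) hne n x y hg hL
    have c1 := hd1 s (hs2 (hs3 (hs4 hs))) t (hs2 (hs3 (hs4 ht))) hne n x y hg hL
    refine aux_final R S C hR hS hRS hC x₁ y₁ hx₁ hl₁ x₂ y₂ hx₂ hl₂ x y
      (good_ne p hp a ha x y hg) (n - k4) (n - k3) (n - k2) (n - k1)
      (by omega) (by omega) (by omega) (by omega) ?_
    rintro m (rfl | rfl | rfl | rfl)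
    exacts [c4.2, c3.2, c2.2, c1.2]
  · exact hinf (case_eq V p hp hV a ha R S C hR Λ H1' hr)
  · refine case_gt V p hp hV a ha R S C hR Λ H1' ?_ hr
    intro K hK
    obtain ⟨l, hl, l', hl', hne, h, -⟩ := H2 K hK
    exact ⟨l, hl, l', hl', hne, h⟩


def BkF (r s C : ℝ) (k : ℕ) (ξ : Fin 2 → ℝ) : Fin 2 → ℝ :=
  ![r ^ k * ξ 0, C * (r ^ k * ξ 0) + s ^ k * (ξ 1 - C * ξ 0)]

def BTF (r s C : ℝ) (k : ℕ) (d : Fin 2 → ℝ) : Fin 2 → ℝ :=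
  ![r ^ k * d 0 + C * (r ^ k - s ^ k) * d 1, s ^ k * d 1]

theorem BkF_zero (r s C : ℝ) (ξ) : BkF r s C 0 ξ = ξ := by
  ext i; fin_cases i <;> simp [BkF]

theorem BkF_add (r s C : ℝ) (k l : ℕ) (ξ) : BkF r s C k (BkF r s C l ξ) = BkF r s C (k + l) ξ := by
  ext i; fin_cases i <;> simp [BkF] <;> ring

theorem BTF_add (r s C : ℝ) (k) (x y) : BTF r s C k (x + y) = BTF r s C k x + BTF r s C k y := by
  ext i; fin_cases i <;> simp [BTF] <;> ring

theorem BTF_cont (r s C : ℝ) (k) : Continuous (BTF r s C k) := by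
  refine continuous_pi fun i => ?_
  fin_cases i <;> simp [BTF] <;> fun_prop

theorem BkF_cont (r s C : ℝ) (k) : Continuous (BkF r s C k) := by
  refine continuous_pi fun i => ?_
  fin_cases i <;> simp [BkF] <;> fun_prop

theorem expChar_BT (r s C : ℝ) (k) (ξ x) :
    expChar ξ (BTF r s C k x) = expChar (BkF r s C k ξ) x := by
  unfold expChar BTF BkF
  congr 2
  simp
  ring

theorem expChar_add (ξ x y) : expChar ξ (x + y) = expChar ξ x * expChar ξ y := by
  unfold expChar
  rw [← Complex.exp_add]
  congr 1
  simp
  ring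

theorem expChar_norm (ξ x) : ‖expChar ξ x‖ = 1 := by
  unfold expChar
  have : (-2 * Real.pi * Complex.I) * ((ξ 0 * x 0 + ξ 1 * x 1 : ℝ) : ℂ)
      = ((-2 * Real.pi * (ξ 0 * x 0 + ξ 1 * x 1) : ℝ) : ℂ) * Complex.I := by
    push_cast; ring
  rw [this, Complex.norm_exp_ofReal_mul_I]

theorem expChar_sub (ξ η x) : (starRingEnd ℂ) (expChar η x) * expChar ξ x = expChar (ξ - η) x := by
  unfold expChar
  rw [← Complex.exp_conj, ← Complex.exp_add]
  congr 1
  simp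
  have : (starRingEnd ℂ) 2 = 2 := map_ofNat _ 2
  rw [this]
  ring

theorem expChar_zero (x) : expChar 0 x = 1 := by simp [expChar]
theorem expChar_zero' (x) : expChar x 0 = 1 := by simp [expChar]

theorem expChar_cont (ξ) : Continuous (expChar ξ) := by
  unfold expChar; fun_prop

theorem expChar_cont' (x) : Continuous (fun ξ => expChar ξ x) := by
  unfold expChar; fun_prop

theorem expChar_int (μ : Measure (Fin 2 → ℝ)) [IsFiniteMeasure μ] (ξ) : Integrable (expChar ξ) μ :=
  Integrable.of_bound (expChar_cont ξ).aestronglyMeasurable 1 (by simp [expChar_norm])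

theorem ft_cont (μ : Measure (Fin 2 → ℝ)) [IsProbabilityMeasure μ] : Continuous (ftMeasure μ) := by
  unfold ftMeasure
  refine continuous_of_dominated (bound := fun _ => 1) ?_ ?_ ?_ ?_
  · intro x; exact (expChar_cont x).aestronglyMeasurable
  · intro x; simp [expChar_norm]
  · simp
  · exact Filter.Eventually.of_forall fun x => expChar_cont' x

theorem ft_zero (μ : Measure (Fin 2 → ℝ)) [IsProbabilityMeasure μ] : ftMeasure μ 0 = 1 := by
  simp [ftMeasure, expChar_zero]

theorem ft_BT (μ : Measure (Fin 2 → ℝ)) [IsProbabilityMeasure μ] (r s C : ℝ) (k) (ξ) :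
    ftMeasure (μ.map (BTF r s C k)) ξ = ftMeasure μ (BkF r s C k ξ) := by
  unfold ftMeasure
  rw [integral_map (BTF_cont r s C k).aemeasurable (expChar_cont ξ).aestronglyMeasurable]
  simp [expChar_BT]

/-- convolution with the uniform measure on shifts -/
def convD {p : ℕ} (d : Fin p → (Fin 2 → ℝ)) (ν : Measure (Fin 2 → ℝ)) : Measure (Fin 2 → ℝ) :=
  (p : ℝ≥0∞)⁻¹ • ∑ i : Fin p, ν.map (fun x => x + d i)

theorem convD_prob {p : ℕ} (hp : p ≠ 0) (d : Fin p → (Fin 2 → ℝ)) (ν : Measure (Fin 2 → ℝ))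
    [IsProbabilityMeasure ν] : IsProbabilityMeasure (convD d ν) := by
  constructor
  have : ∀ i, (ν.map (fun x => x + d i)) Set.univ = 1 := fun i => by
    rw [Measure.map_apply (by fun_prop) MeasurableSet.univ]; simp
  simp [convD, this]
  exact ENNReal.inv_mul_cancel (by simpa using hp) (by simp)

theorem convD_ft {p : ℕ} (d : Fin p → (Fin 2 → ℝ)) (ν : Measure (Fin 2 → ℝ))
    [IsProbabilityMeasure ν] (ξ) :
    ftMeasure (convD d ν) ξ = mask d ξ * ftMeasure ν ξ := by
  unfold ftMeasure convD mask
  have hP : ∀ i, IsProbabilityMeasure (ν.map (fun x => x + d i)) := fun i =>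
    Measure.isProbabilityMeasure_map (by fun_prop)
  rw [integral_smul_measure, integral_finsetSum_measure (fun i _ => expChar_int _ ξ)]
  have : ∀ i, ∫ x, expChar ξ x ∂(ν.map (fun x => x + d i)) = expChar ξ (d i) * ∫ x, expChar ξ x ∂ν := by
    intro i
    rw [integral_map (by fun_prop) (expChar_cont ξ).aestronglyMeasurable]
    simp_rw [expChar_add]
    rw [integral_mul_const, mul_comm]
  simp_rw [this]
  rw [← Finset.sum_mul]
  simp [mul_assoc]

theorem mask_BT {p : ℕ} (D : Fin p → (Fin 2 → ℝ)) (r s C : ℝ) (k) (ξ) :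
    mask (fun i => BTF r s C k (D i)) ξ = mask D (BkF r s C k ξ) := by
  simp [mask, expChar_BT]

theorem mask_le {p : ℕ} (hp : p ≠ 0) (D : Fin p → (Fin 2 → ℝ)) (ξ) : ‖mask D ξ‖ ≤ 1 := by
  unfold mask
  rw [norm_mul]
  have : ‖∑ i : Fin p, expChar ξ (D i)‖ ≤ p := by
    refine (norm_sum_le _ _).trans ?_
    simp [expChar_norm]
  have hp' : (0:ℝ) < p := by positivity
  simp
  rw [inv_mul_le_iff₀ hp']
  simpa using this

/-- partial convolutions -/
theorem exists_nu {p : ℕ} (hp : p ≠ 0) (D : Fin p → (Fin 2 → ℝ)) (r s C : ℝ) (μ : Measure (Fin 2 → ℝ))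
    [IsProbabilityMeasure μ] (K n : ℕ) : ∃ ν : Measure (Fin 2 → ℝ), IsProbabilityMeasure ν ∧
      ∀ ξ, ftMeasure ν ξ = (∏ i ∈ Finset.range n, mask D (BkF r s C (i + 1) ξ)) *
        ftMeasure μ (BkF r s C K ξ) := by
  induction n with
  | zero =>
    exact ⟨μ.map (BTF r s C K), Measure.isProbabilityMeasure_map (BTF_cont r s C K).aemeasurable,
      fun ξ => by simp [ft_BT]⟩
  | succ n ih =>
    obtain ⟨ν, h1, h2⟩ := ih
    refine ⟨convD (fun i => BTF r s C (n + 1) (D i)) ν, convD_prob hp _ _, fun ξ => ?_⟩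
    rw [convD_ft, mask_BT, h2, Finset.prod_range_succ]
    ring

theorem ft_iter {p : ℕ} (D : Fin p → (Fin 2 → ℝ)) (r s C : ℝ) (μ : Measure (Fin 2 → ℝ))
    (h : ∀ ξ, ftMeasure μ ξ = mask D (BkF r s C 1 ξ) * ftMeasure μ (BkF r s C 1 ξ)) (n : ℕ) (ξ) :
    ftMeasure μ ξ = (∏ i ∈ Finset.range n, mask D (BkF r s C (i + 1) ξ)) *
        ftMeasure μ (BkF r s C n ξ) := by
  induction n with
  | zero => simp [BkF_zero]
  | succ n ih =>
    rw [ih, h (BkF r s C n ξ), BkF_add, Finset.prod_range_succ, add_comm 1 n]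
    ring

theorem Bk_tendsto (r s C : ℝ) (hr : 0 < r) (hr1 : r < 1) (hs : 0 < s) (hs1 : s < 1) (ξ) :
    Filter.Tendsto (fun n => BkF r s C n ξ) Filter.atTop (nhds 0) := by
  have h1 := tendsto_pow_atTop_nhds_zero_of_lt_one hr.le hr1
  have h2 := tendsto_pow_atTop_nhds_zero_of_lt_one hs.le hs1
  rw [tendsto_pi_nhds]
  intro i
  fin_cases i
  · simpa [BkF] using h1.mul_const (ξ 0)
  · have := ((h1.mul_const (ξ 0)).const_mul C).add (h2.mul_const (ξ 1 - C * ξ 0))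
    simpa [BkF] using this

theorem ft_zero_mask {p : ℕ} (D : Fin p → (Fin 2 → ℝ)) (r s C : ℝ) (hr : 0 < r) (hr1 : r < 1)
    (hs : 0 < s) (hs1 : s < 1) (μ : Measure (Fin 2 → ℝ)) [IsProbabilityMeasure μ]
    (h : ∀ ξ, ftMeasure μ ξ = mask D (BkF r s C 1 ξ) * ftMeasure μ (BkF r s C 1 ξ)) (ξ)
    (h0 : ftMeasure μ ξ = 0) : ∃ k, 1 ≤ k ∧ mask D (BkF r s C k ξ) = 0 := by
  have ht := ((ft_cont μ).tendsto 0).comp (Bk_tendsto r s C hr hr1 hs hs1 ξ)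
  rw [ft_zero] at ht
  obtain ⟨n, hn⟩ := (ht.eventually_ne one_ne_zero).exists
  rw [ft_iter D r s C μ h n] at h0
  rcases mul_eq_zero.1 h0 with h0 | h0
  · obtain ⟨i, _, hi⟩ := Finset.prod_eq_zero_iff.1 h0
    exact ⟨i + 1, by omega, hi⟩
  · exact absurd h0 hn

theorem mask_ft_zero {p : ℕ} (D : Fin p → (Fin 2 → ℝ)) (r s C : ℝ) (μ : Measure (Fin 2 → ℝ))
    (h : ∀ ξ, ftMeasure μ ξ = mask D (BkF r s C 1 ξ) * ftMeasure μ (BkF r s C 1 ξ)) (ξ) (k : ℕ)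
    (hk : 1 ≤ k) (h0 : mask D (BkF r s C k ξ) = 0) : ftMeasure μ ξ = 0 := by
  rw [ft_iter D r s C μ h k]
  obtain ⟨k, rfl⟩ : ∃ m, k = m + 1 := ⟨k - 1, by omega⟩
  rw [Finset.prod_range_succ, h0]; simp

theorem ft_self {p : ℕ} (D : Fin p → (Fin 2 → ℝ)) (r s c : ℝ) (hr : 0 < r) 
    (hs : 0 < s) (hrs : r ≠ s) (μ : Measure (Fin 2 → ℝ))
    (hμ : IsSelfAffine μ (Mupper r s c) D) (ξ) :
    ftMeasure μ ξ = mask D (BkF r s (c / (r⁻¹ - s⁻¹)) 1 ξ) * ftMeasure μ (BkF r s (c / (r⁻¹ - s⁻¹)) 1 ξ) := by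
  obtain ⟨hP, _, h⟩ := hμ
  set C := c / (r⁻¹ - s⁻¹) with hC
  have hne : r⁻¹ - s⁻¹ ≠ 0 := fun h => hrs (inv_injective (sub_eq_zero.1 h))
  have hc : c = C * (r⁻¹ - s⁻¹) := by rw [hC]; field_simp
  have hinv : (Mupper r s c)⁻¹ = !![r, C * (r - s); 0, s] := by
    apply Matrix.inv_eq_right_inv
    rw [hc]
    ext i j
    fin_cases i <;> fin_cases j <;> simp [Mupper, Matrix.mul_apply, Fin.sum_univ_two] <;> field_simp
    ring
  have hmv : ∀ x, (Mupper r s c)⁻¹.mulVec x = BTF r s C 1 x := by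
    intro x
    rw [hinv]
    ext i
    fin_cases i <;> simp [BTF, Matrix.mulVec, dotProduct, Fin.sum_univ_two]
  have h' : μ = convD (fun i => BTF r s C 1 (D i)) (μ.map (BTF r s C 1)) := by
    conv_lhs => rw [h]
    unfold convD
    congr 1
    refine Finset.sum_congr rfl fun i _ => ?_
    rw [Measure.map_map (by fun_prop) (BTF_cont r s C 1).measurable]
    congr 1
    ext x : 1
    simp only [hmv, BTF_add, Function.comp]
  have := Measure.isProbabilityMeasure_map (μ := μ) (BTF_cont r s C 1).aemeasurable
  conv_lhs => rw [h']
  rw [convD_ft, mask_BT, ft_BT]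

theorem mask_lev (p : ℕ) (D : Fin p → (Fin 2 → ℤ)) (a : Fin 2 → ℤ) (hZ : ZeroSetCond p D a)
    (r s C : ℝ) (hr : 0 < r) (hs : 0 < s) (k : ℕ) (ξ : Fin 2 → ℝ) :
    mask (digitR D) (BkF r s C k ξ) = 0 ↔ Lev p a r⁻¹ s⁻¹ C k ξ := by
  rw [hZ.2]
  have hrk : r ^ k ≠ 0 := by positivity
  have hsk : s ^ k ≠ 0 := by positivity
  constructor
  · rintro ⟨j, h1, h2, n, h⟩
    refine ⟨j * a 0 / p + n 0, j * a 1 / p + n 1, ⟨j, h1, h2, n 0, n 1, rfl, rfl⟩, ?_, ?_⟩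
    · have := h 0
      simp [BkF] at this
      push_cast
      rw [← this, inv_pow]; field_simp
    · have e0 := h 0
      have e1 := h 1
      simp [BkF] at e0 e1
      push_cast
      rw [← e0, ← e1, inv_pow]; field_simp; ring
  · rintro ⟨x, y, ⟨j, h1, h2, n, m, hx, hy⟩, h3, h4⟩
    refine ⟨j, h1, h2, ![n, m], ?_⟩
    have hx' : (x : ℝ) = j * a 0 / p + n := by rw [hx]; push_cast; rfl
    have hy' : (y : ℝ) = j * a 1 / p + m := by rw [hy]; push_cast; rfl
    have q : r ^ k * ξ 0 = x := by rw [h3, inv_pow]; field_simp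
    intro i
    fin_cases i
    · simp [BkF]; rw [q, hx']
    · simp [BkF]; rw [q, h4, inv_pow]; field_simp; linarith

/-- Exponentials in `L²`. -/
def EL (μ : Measure (Fin 2 → ℝ)) [IsProbabilityMeasure μ] (ξ : Fin 2 → ℝ) : Lp ℂ 2 μ :=
  MemLp.toLp (expChar ξ) (MemLp.of_bound (expChar_cont ξ).aestronglyMeasurable 1
    (by simp [expChar_norm]))

theorem EL_inner (μ : Measure (Fin 2 → ℝ)) [IsProbabilityMeasure μ] (ξ η) :
    inner ℂ (EL μ ξ) (EL μ η) = ftMeasure μ (η - ξ) := by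
  rw [L2.inner_def]
  unfold ftMeasure
  refine integral_congr_ae ?_
  have h1 : EL μ ξ =ᵐ[μ] expChar ξ := MemLp.coeFn_toLp _
  have h2 : EL μ η =ᵐ[μ] expChar η := MemLp.coeFn_toLp _
  filter_upwards [h1, h2] with x hx hy
  rw [hx, hy, ← expChar_sub]
  simp [mul_comm]

theorem EL_norm (μ : Measure (Fin 2 → ℝ)) [IsProbabilityMeasure μ] (ξ) : ‖EL μ ξ‖ = 1 := by
  have h := EL_inner μ ξ ξ
  rw [sub_self, ft_zero, inner_self_eq_norm_sq_to_K] at h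
  have : ‖EL μ ξ‖ ^ 2 = 1 := by
    have h := congrArg Complex.re h
    rw [← RCLike.ofReal_pow] at h
    simpa only [Complex.coe_algebraMap, RCLike.ofReal_real_eq_id, Complex.ofReal_re, Complex.one_re] using h
  nlinarith [norm_nonneg (EL μ ξ)]

theorem EL_bessel (ν : Measure (Fin 2 → ℝ)) [IsProbabilityMeasure ν] (Λ : Set (Fin 2 → ℝ))
    (h : ∀ l ∈ Λ, ∀ l' ∈ Λ, l ≠ l' → ftMeasure ν (l - l') = 0) (ξ) :
    Summable (fun l : Λ => ‖ftMeasure ν (ξ - l)‖ ^ 2) ∧ ∑' l : Λ, ‖ftMeasure ν (ξ - l)‖ ^ 2 ≤ 1 := by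
  have ho : Orthonormal ℂ (fun l : Λ => EL ν l) := by
    refine ⟨fun l => EL_norm ν l, fun i j hij => ?_⟩
    show inner ℂ (EL ν i) (EL ν j) = 0
    rw [EL_inner]
    exact h _ j.2 _ i.2 fun e => hij (Subtype.ext e.symm)
  have h1 := ho.inner_products_summable (x := EL ν ξ)
  have h2 := ho.tsum_inner_products_le (x := EL ν ξ)
  simp only [EL_inner, EL_norm, one_pow] at h1 h2
  exact ⟨h1, h2⟩

theorem EL_parseval (μ : Measure (Fin 2 → ℝ)) [IsProbabilityMeasure μ] (Λ : Set (Fin 2 → ℝ))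
    (b : HilbertBasis Λ ℂ (Lp ℂ 2 μ)) (hb : ∀ lam : Λ, ⇑(b lam) =ᵐ[μ] expChar (lam : Fin 2 → ℝ)) :
    (∀ l ∈ Λ, ∀ l' ∈ Λ, l ≠ l' → ftMeasure μ (l - l') = 0) ∧
    ∀ ξ, HasSum (fun l : Λ => ‖ftMeasure μ (ξ - l)‖ ^ 2) 1 := by
  have hE : ∀ l : Λ, b l = EL μ l := fun l => Lp.ext ((hb l).trans (MemLp.coeFn_toLp _).symm)
  constructor
  · intro l hl l' hl' hne
    rw [← EL_inner, ← hE ⟨l, hl⟩, ← hE ⟨l', hl'⟩]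
    exact b.orthonormal.2 fun e => hne (by simpa using e.symm)
  · intro ξ
    have := b.hasSum_inner_mul_inner (EL μ ξ) (EL μ ξ)
    rw [EL_inner, sub_self, ft_zero] at this
    have h2 : ∀ l : Λ, inner ℂ (EL μ ξ) (b l) * inner ℂ (b l) (EL μ ξ)
        = ((‖ftMeasure μ (ξ - l)‖ ^ 2 : ℝ) : ℂ) := by
      intro l
      rw [← inner_conj_symm, hE, EL_inner, Complex.conj_mul']
      push_cast; rfl
    simp_rw [h2] at this
    have h3 := Complex.hasSum_re this
    simpa only [Complex.ofReal_re, Complex.one_re] using h3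

theorem mask_lt {p : ℕ} (hp : p.Prime) (D : Fin p → (Fin 2 → ℝ)) (ξ)
    (h0 : D ⟨0, hp.pos⟩ = 0) (h1 : expChar ξ (D ⟨1, hp.one_lt⟩) ≠ 1) : ‖mask D ξ‖ < 1 := by
  unfold mask
  set w := expChar ξ (D ⟨1, hp.one_lt⟩) with hw
  have hw1 : ‖w‖ = 1 := expChar_norm _ _
  have hlt : ‖(1:ℂ) + w‖ < 2 := by
    refine lt_of_le_of_ne ((norm_add_le _ _).trans (by rw [hw1, norm_one]; norm_num)) fun e => h1 ?_
    have hs : SameRay ℝ (1:ℂ) w := sameRay_iff_norm_add.2 (by rw [e, hw1, norm_one]; norm_num)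
    exact ((sameRay_iff_of_norm_eq (by rw [hw1, norm_one])).1 hs).symm
  have hne : (⟨0, hp.pos⟩ : Fin p) ≠ ⟨1, hp.one_lt⟩ := by simp
  have hp' : (0:ℝ) < p := by exact_mod_cast hp.pos
  have : ‖∑ i : Fin p, expChar ξ (D i)‖ < p := by
    rw [← Finset.add_sum_erase _ _ (Finset.mem_univ (⟨0, hp.pos⟩ : Fin p)),
      ← Finset.add_sum_erase _ _ (show (⟨1, hp.one_lt⟩ : Fin p) ∈ Finset.univ.erase ⟨0, hp.pos⟩ by
        simp), h0, expChar_zero', ← add_assoc]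
    refine (norm_add_le _ _).trans_lt ?_
    have hb : ‖∑ i ∈ (Finset.univ.erase (⟨0, hp.pos⟩ : Fin p)).erase ⟨1, hp.one_lt⟩, expChar ξ (D i)‖
        ≤ (p : ℝ) - 2 := by
      refine (norm_sum_le _ _).trans ?_
      simp only [expChar_norm, Finset.sum_const, nsmul_eq_mul, mul_one]
      rw [Finset.card_erase_of_mem (by simp), Finset.card_erase_of_mem (by simp)]
      simp
      have := hp.two_le
      rw [Nat.sub_sub, Nat.cast_sub this]; simp
    linarith
  rw [norm_mul]
  simp only [norm_inv, Complex.norm_natCast]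
  rw [inv_mul_lt_iff₀ hp']
  simpa using this

theorem exists_eta {p : ℕ} (hp : p.Prime) (D : Fin p → (Fin 2 → ℤ)) (r s C : ℝ) (hr : 0 < r)
    (hs : 0 < s) (K : ℕ)
    (hD0 : D ⟨0, hp.pos⟩ = 0)
    (hD11 : D ⟨1, hp.one_lt⟩ 1 = 0) (hD10 : D ⟨1, hp.one_lt⟩ 0 ≠ 0)
    (ν : Measure (Fin 2 → ℝ)) [IsProbabilityMeasure ν] :
    ∃ η, ftMeasure ν η ≠ 0 ∧ ‖mask (digitR D) (BkF r s C K η)‖ < 1 := by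
  have hrk : r ^ K ≠ 0 := by positivity
  let f : ℕ → (Fin 2 → ℝ) := fun n => ![(1 / ((n : ℝ) + 1)), 0]
  have hf : Filter.Tendsto f Filter.atTop (nhds 0) := by
    rw [tendsto_pi_nhds]
    intro i
    fin_cases i
    · simpa [f] using tendsto_one_div_add_atTop_nhds_zero_nat (𝕜 := ℝ)
    · simp [f]
  set d : ℝ := (D ⟨1, hp.one_lt⟩ 0 : ℝ) with hd
  have hd0 : d ≠ 0 := by rw [hd]; exact_mod_cast hD10
  have ht := ((ft_cont ν).tendsto 0).comp hf
  rw [ft_zero] at ht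
  have hsm : Filter.Tendsto (fun n : ℕ => |r ^ K * d| * (1 / ((n : ℝ) + 1))) Filter.atTop (nhds 0) := by
    simpa using (tendsto_one_div_add_atTop_nhds_zero_nat (𝕜 := ℝ)).const_mul |r ^ K * d|
  obtain ⟨n, h1, h2⟩ := ((ht.eventually_ne one_ne_zero).and
    (hsm.eventually (gt_mem_nhds one_pos))).exists
  refine ⟨f n, h1, mask_lt hp _ _ ?_ ?_⟩
  · ext i; simp [digitR, hD0]
  · intro h
    unfold expChar at h
    rw [Complex.exp_eq_one_iff] at h
    obtain ⟨m, hm⟩ := h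
    simp only [digitR, hD11, BkF, f] at hm
    simp only [← hd] at hm
    have hpi : (2 * Real.pi * Complex.I : ℂ) ≠ 0 := Complex.two_pi_I_ne_zero
    have e : ((-(r ^ K * (1 / ((n : ℝ) + 1)) * d) : ℝ) : ℂ) = ((m : ℝ) : ℂ) := by
      apply mul_right_cancel₀ hpi
      push_cast
      rw [← hm]
      simp
      ring
    have hem := Complex.ofReal_injective e
    have hn : (0:ℝ) < 1 / ((n : ℝ) + 1) := by positivity
    have hab : |(m : ℝ)| < 1 := by
      rw [← hem, abs_neg]
      calc _ = |r ^ K * d| * (1 / ((n : ℝ) + 1)) := by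
            rw [← abs_of_pos hn, ← abs_mul]; congr 1; rw [abs_of_pos hn]; ring
        _ < 1 := h2
    have hm0 : m = 0 := by
      have : |m| < 1 := by exact_mod_cast hab
      exact Int.abs_lt_one_iff.1 this
    rw [hm0] at hem
    have : r ^ K * (1 / ((n : ℝ) + 1)) * d ≠ 0 := by positivity
    apply this
    simpa using hem

/-- Theorem 1.4: with `ρ₁ ≠ ρ₂`, if `c'' = c/(ρ₁⁻¹ − ρ₂⁻¹) ∉ ℚ` then `μ_{M,D}` is not a
spectral measure. -/
theorem stmt5 (p : ℕ) (hp : p.Prime) (ρ₁ ρ₂ c : ℝ)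
    (hρ10 : 0 < ρ₁) (hρ11 : ρ₁ < 1) (hρ20 : 0 < ρ₂) (hρ21 : ρ₂ < 1) (hρ : ρ₁ ≠ ρ₂)
    (D : Fin p → (Fin 2 → ℤ)) (hD : Function.Injective D)
    (a : Fin 2 → ℤ) (hZ : ZeroSetCond p D a)
    (hD0 : D ⟨0, hp.pos⟩ = 0)
    (hD11 : D ⟨1, hp.one_lt⟩ 1 = 0) (hD10 : D ⟨1, hp.one_lt⟩ 0 ≠ 0)
    (μ : Measure (Fin 2 → ℝ)) (hμ : IsSelfAffine μ (Mupper ρ₁ ρ₂ c) (digitR D))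
    (hirr : ∀ q : ℚ, c / (ρ₁⁻¹ - ρ₂⁻¹) ≠ (q : ℝ)) :
    ¬ IsSpectral μ := by
  rintro ⟨Λ, _, b, hb⟩
  have hP : IsProbabilityMeasure μ := hμ.1
  have hft := ft_self (digitR D) ρ₁ ρ₂ c hρ10 hρ20 hρ μ hμ
  set C := c / (ρ₁⁻¹ - ρ₂⁻¹) with hC
  obtain ⟨hort, hpars⟩ := EL_parseval μ Λ b hb
  have hml := mask_lev p D a hZ ρ₁ ρ₂ C hρ10 hρ20
  have hex : ∀ l ∈ Λ, ∀ l' ∈ Λ, l ≠ l' → ∃ k, 1 ≤ k ∧ mask (digitR D) (BkF ρ₁ ρ₂ C k (l - l')) = 0 :=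
    fun l hl l' hl' hne => ft_zero_mask _ _ _ _ hρ10 hρ11 hρ20 hρ21 μ hft _ (hort l hl l' hl' hne)
  refine comb p hp a hZ.1 ρ₁⁻¹ ρ₂⁻¹ C ((one_lt_inv₀ hρ10).2 hρ11) ((one_lt_inv₀ hρ20).2 hρ21)
    (fun h => hρ (inv_injective h)) (fun ⟨q, hq⟩ => hirr q hq.symm) Λ ?_ ?_
  · intro l hl l' hl' hne
    obtain ⟨k, hk, h⟩ := hex l hl l' hl' hne
    exact ⟨k, hk, (hml k _).1 h⟩
  · intro K hK
    by_contra hcon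
    push Not at hcon
    obtain ⟨n, rfl⟩ : ∃ n, K = n + 1 := ⟨K - 1, by omega⟩
    obtain ⟨ν, hν, hνft⟩ := exists_nu hp.ne_zero (digitR D) ρ₁ ρ₂ C μ (n + 1) n
    have hfac : ∀ ξ, ftMeasure μ ξ = mask (digitR D) (BkF ρ₁ ρ₂ C (n + 1) ξ) * ftMeasure ν ξ := by
      intro ξ
      rw [hνft, ft_iter _ _ _ _ μ hft (n + 1) ξ, Finset.prod_range_succ]
      ring
    have hνort : ∀ l ∈ Λ, ∀ l' ∈ Λ, l ≠ l' → ftMeasure ν (l - l') = 0 := by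
      intro l hl l' hl' hne
      obtain ⟨k, hk, hkK, h⟩ : ∃ k, 1 ≤ k ∧ k ≠ n + 1 ∧
          mask (digitR D) (BkF ρ₁ ρ₂ C k (l - l')) = 0 := by
        obtain ⟨k, hk, h⟩ := hex l hl l' hl' hne
        by_cases hkK : k = n + 1
        · subst hkK
          obtain ⟨k, hk, h1, h2⟩ := hcon l hl l' hl' hne ((hml _ _).1 h)
          exact ⟨k, hk, h2, (hml _ _).2 h1⟩
        · exact ⟨k, hk, hkK, h⟩
      rw [hνft]
      rcases lt_or_gt_of_ne hkK with hlt | hgt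
      · rw [Finset.prod_eq_zero (i := k - 1) (Finset.mem_range.2 (by omega)), zero_mul]
        rwa [Nat.sub_add_cancel hk]
      · rw [mask_ft_zero (digitR D) ρ₁ ρ₂ C μ hft _ (k - (n + 1)) (by omega), mul_zero]
        rwa [BkF_add, Nat.sub_add_cancel hgt.le]
    obtain ⟨η, hη, hm⟩ := exists_eta hp D ρ₁ ρ₂ C hρ10 hρ20 (n + 1) hD0 hD11 hD10 ν
    have hne : Nonempty Λ := by
      by_contra he
      rw [not_nonempty_iff] at he
      have := (hpars 0).tsum_eq
      simp at this
    obtain ⟨l0⟩ := hne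
    obtain ⟨hs, hle⟩ := EL_bessel ν Λ hνort (η + l0)
    have hp1 := hpars (η + l0)
    have hlt := Summable.tsum_lt_tsum (i := l0) (fun l => ?_) ?_ hp1.summable hs
    · rw [hp1.tsum_eq] at hlt
      linarith
    · show ‖ftMeasure μ (η + l0 - l)‖ ^ 2 ≤ ‖ftMeasure ν (η + l0 - l)‖ ^ 2
      rw [hfac, norm_mul]
      have := mask_le hp.ne_zero (digitR D) (BkF ρ₁ ρ₂ C (n + 1) (η + l0 - l))
      gcongr
      exact mul_le_of_le_one_left (norm_nonneg _) this
    · show ‖ftMeasure μ (η + l0 - l0)‖ ^ 2 < ‖ftMeasure ν (η + l0 - l0)‖ ^ 2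
      rw [add_sub_cancel_right, hfac, norm_mul]
      have := norm_pos_iff.2 hη
      gcongr
      exact mul_lt_of_lt_one_left this hm

end
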